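/- Let (X, ρ, 𝒞, Δ) and (X̃, ρ̃, 𝒞̃, Δ̃) be semi-Cartan graphs with GRS, and let F : X̃ → X be a covering, i.e. F is surjective, ρ_i ∘ F = F ∘ ρ̃_i, C^{F(x)} = C^x and Δ^{F(x)} = Δ^x for all x ∈ X̃, i ∈ I. Let 𝒩 and 𝒩' be the nil-Hecke algebras of (X, ρ, 𝒞) and (X̃, ρ̃, 𝒞̃) over a commutative ring 𝕂. Then there is a well-defined injective 𝕂-algebra homomorphism F : 𝒩 → 𝒩' with F(e^x) = Σ_{y ∈ F⁻¹(x)} e^y and F(n_i^x) = Σ_{y ∈ F⁻¹(x)} n_i^y for all x ∈ X, i ∈ I. -/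

import Mathlib

open CategoryTheory

noncomputable section

namespace WeylGroupoid

variable {θ : ℕ} {X : Type} [Fintype X] [DecidableEq X]

/-- A *semi-Cartan graph*: a basic datum `(X, ρ)` together with a compatible bundle of
generalized Cartan matrices. -/
structure SCG (θ : ℕ) (X : Type) [Fintype X] [DecidableEq X] : Type where
  nonempty : Nonempty X
  /-- the involutions `ρ_i` of the basic datum -/
  ρ : Fin θ → X → X
  invol : ∀ i x, ρ i (ρ i x) = x
  /-- the bundle of generalized Cartan matrices `C^x` -/
  C : X → Fin θ → Fin θ → ℤ
  diag : ∀ x i, C x i i = 2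
  offdiag : ∀ x i j, i ≠ j → C x i j ≤ 0
  zero_iff : ∀ x i j, i ≠ j → (C x i j = 0 ↔ C x j i = 0)
  compat : ∀ x i j, C (ρ i x) i j = C x i j

/-- the simple root `α_i ∈ ℤ^θ` -/
def al (θ : ℕ) (i : Fin θ) : Fin θ → ℤ := Pi.single i 1

/-- the reflection `s_i^x` of `ℤ^θ`, `s_i^x (α_j) = α_j - c^x_{ij} α_i` -/
def srefl (G : SCG θ X) (x : X) (i : Fin θ) (v : Fin θ → ℤ) : Fin θ → ℤ :=
  fun k => v k - (if k = i then ∑ j, G.C x i j * v j else 0)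

/-- the cone `ℕ₀ α_i + ℕ₀ α_j` -/
def pairCone (θ : ℕ) (i j : Fin θ) : Set (Fin θ → ℤ) :=
  {v | ∃ a b : ℕ, v = (a : ℤ) • al θ i + (b : ℤ) • al θ j}

/-- A *generalized root system* on a semi-Cartan graph. -/
structure GRS (G : SCG θ X) : Type where
  /-- the root sets `Δ^x` -/
  Δ : X → Set (Fin θ → ℤ)
  pos_neg : ∀ x, Δ x = (Δ x ∩ {v | ∀ k, 0 ≤ v k}) ∪ (-(Δ x ∩ {v | ∀ k, 0 ≤ v k}))
  simple : ∀ x i, Δ x ∩ {v | ∃ c : ℤ, v = c • al θ i} = {al θ i, -al θ i}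
  reflect : ∀ x i, (srefl G x i) '' Δ x = Δ (G.ρ i x)
  pairFinite : ∀ x i j, (Δ x ∩ pairCone θ i j).Finite
  loop : ∀ x i j, (fun y => G.ρ i (G.ρ j y))^[(Δ x ∩ pairCone θ i j).ncard] x = x

variable (G : SCG θ X)

/-- The entries `m^x_{ij} = |Δ^x ∩ (ℕ₀α_i + ℕ₀α_j)|`. -/
def mnum (R : GRS G) (x : X) (i j : Fin θ) : ℕ := (R.Δ x ∩ pairCone θ i j).ncard

/-- the set of positive roots `Δ^x_+` -/
def posRoots (R : GRS G) (x : X) : Set (Fin θ → ℤ) := R.Δ x ∩ {v | ∀ k, 0 ≤ v k}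

/-- The objects of the Weyl groupoid (a type synonym for `X` carrying a quiver
structure depending on `G`). -/
def Obj (G : SCG θ X) : Type := X

instance : Quiver (Obj G) := ⟨fun a b => {i : Fin θ // G.ρ i (show X from b) = (show X from a)}⟩

/-- objects of the path category -/
def pob (x : X) : Paths (Obj G) := (x : X)

/-- the generating arrow `σ_i^x : ρ_i(x) → x` -/
def genArrow (x : X) (i : Fin θ) : pob G (G.ρ i x) ⟶ pob G x :=
  Quiver.Path.nil.cons (⟨i, rfl⟩ : (show Obj G from G.ρ i x) ⟶ (show Obj G from x))

/-- the source of the word `σ_{i_1}^x σ_{i_2} ⋯ σ_{i_m}` (with target `x`) -/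
def wsrc (G : SCG θ X) : List (Fin θ) → X → X
  | [], x => x
  | i :: l, x => wsrc G l (G.ρ i x)

/-- the path `σ_{i_1}^x σ_{i_2} ⋯ σ_{i_m} : wsrc(w,x) → x` in the free category -/
def pathOf (G : SCG θ X) : (w : List (Fin θ)) → (x : X) → (pob G (wsrc G w x) ⟶ pob G x)
  | [], _ => 𝟙 _
  | i :: l, x => (pathOf G l (G.ρ i x)) ≫ genArrow G x i


/-- transport a path along an equality of sources -/
def castSrc {a b c : X} (h : a = b) (f : pob G a ⟶ pob G c) : pob G b ⟶ pob G c := by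
  subst h; exact f

/-- the alternating word `[i, j, i, j, …]` of length `n` -/
def altWord (i j : Fin θ) : ℕ → List (Fin θ)
  | 0 => []
  | n + 1 => i :: altWord j i n

/-- The defining relations `(σ_i^x σ_j)^{m^x_{ij}} = id_x` of the Weyl groupoid. -/
inductive wrel (R : GRS G) : HomRel (Paths (Obj G))
  | rel (x : X) (i j : Fin θ)
      (h : wsrc G (altWord i j (2 * mnum G R x i j)) x = x) :
      wrel R (castSrc G h (pathOf G (altWord i j (2 * mnum G R x i j)) x))
        (𝟙 (pob G x))

variable (R : GRS G)

/-- The Weyl groupoid, as the quotient of the free category on the quiver of the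
`σ_i^x` by the relations `(σ_i^x σ_j)^{m^x_{ij}} = id_x` (every generator is invertible
in this quotient, so it is indeed a groupoid). -/
def W := CategoryTheory.Quotient (wrel G R)

instance : Category (W G R) := inferInstanceAs (Category (CategoryTheory.Quotient (wrel G R)))

/-- objects of the Weyl groupoid -/
def objW (x : X) : W G R := ⟨pob G x⟩

/-- hom-sets `𝒲(y, x)` of the Weyl groupoid -/
def homW (y x : X) := objW G R y ⟶ objW G R x

instance {y x : X} : CoeSort (homW G R y x) (objW G R y ⟶ objW G R x) := ⟨id⟩

/-- the morphism of the Weyl groupoid defined by the word `σ_{i_1}^x ⋯ σ_{i_m}` -/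
def morW (w : List (Fin θ)) (x : X) : homW G R (wsrc G w x) x :=
  (Quotient.functor (wrel G R)).map (pathOf G w x)

/-- the generator `σ_i^x : ρ_i(x) → x` in the Weyl groupoid -/
def genW (x : X) (i : Fin θ) : homW G R (G.ρ i x) x :=
  (Quotient.functor (wrel G R)).map (genArrow G x i)

/-- transport a morphism of the Weyl groupoid along an equality of sources -/
def castW {a b c : X} (h : a = b) (f : homW G R a c) : homW G R b c := by
  subst h; exact f

/-- transport a morphism of the Weyl groupoid along an equality of targets -/
def castTgt {a c c' : X} (h : c = c') (f : homW G R a c) : homW G R a c' := by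
  subst h; exact f

/-- the length `ℓ(f)` of a morphism of the Weyl groupoid -/
def len {y x : X} (f : homW G R y x) : ℕ :=
  sInf {n | ∃ w : List (Fin θ), w.length = n ∧
    ∃ h : wsrc G w x = y, castW G R h (morW G R w x) = f}

/-- `w` is a reduced expression of the morphism `f ∈ 𝒲(y,x)` -/
def IsRedEx (w : List (Fin θ)) {y x : X} (f : homW G R y x) : Prop :=
  ∃ h : wsrc G w x = y, castW G R h (morW G R w x) = f ∧ w.length = len G R f


section NilHecke

variable (𝕂 : Type) [CommRing 𝕂]

/-- the generator `e^x` of the free algebra -/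
def eF (x : X) : FreeAlgebra 𝕂 (X ⊕ X × Fin θ) := FreeAlgebra.ι 𝕂 (Sum.inl x)

/-- the generator `n_i^x` of the free algebra -/
def nF (x : X) (i : Fin θ) : FreeAlgebra 𝕂 (X ⊕ X × Fin θ) := FreeAlgebra.ι 𝕂 (Sum.inr (x, i))

/-- the word `n_{i_1}^x n_{i_2} ⋯ n_{i_m}` in the free algebra
(superscripts determined by composability) -/
def nWF (G : SCG θ X) (𝕂 : Type) [CommRing 𝕂] :
    List (Fin θ) → X → FreeAlgebra 𝕂 (X ⊕ X × Fin θ)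
  | [], _ => 1
  | i :: l, x => nF 𝕂 x i * nWF G 𝕂 l (G.ρ i x)

/-- The defining relations of the nil-Hecke algebra of `(X, ρ, 𝒞)`. -/
inductive nrel (R : GRS G) (𝕂 : Type) [CommRing 𝕂] :
    FreeAlgebra 𝕂 (X ⊕ X × Fin θ) → FreeAlgebra 𝕂 (X ⊕ X × Fin θ) → Prop
  | orth (x y : X) (h : x ≠ y) : nrel R 𝕂 (eF 𝕂 x * eF 𝕂 y) 0
  | idem (x : X) : nrel R 𝕂 (eF 𝕂 x * eF 𝕂 x) (eF 𝕂 x)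
  | total : nrel R 𝕂 (∑ x : X, eF 𝕂 x) 1
  | unit_right (x : X) (i : Fin θ) : nrel R 𝕂 (nF 𝕂 x i * eF 𝕂 (G.ρ i x)) (nF 𝕂 x i)
  | unit_left (x : X) (i : Fin θ) : nrel R 𝕂 (eF 𝕂 x * nF 𝕂 x i) (nF 𝕂 x i)
  | nil (x : X) (i : Fin θ) : nrel R 𝕂 (nF 𝕂 (G.ρ i x) i * nF 𝕂 x i) 0
  | braid (x : X) (i j : Fin θ) (hij : i ≠ j) :
      nrel R 𝕂 (nWF G 𝕂 (altWord i j (mnum G R x i j)) x)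
        (nWF G 𝕂 (altWord j i (mnum G R x i j)) x)

/-- The nil-Hecke algebra `𝒩(X, ρ, 𝒞)` of a Weyl groupoid over `𝕂`. -/
def NH := RingQuot (nrel G R 𝕂)

instance : Ring (NH G R 𝕂) := inferInstanceAs (Ring (RingQuot (nrel G R 𝕂)))
instance : Algebra 𝕂 (NH G R 𝕂) := inferInstanceAs (Algebra 𝕂 (RingQuot (nrel G R 𝕂)))

/-- the generator `e^x` of the nil-Hecke algebra -/
def eN (x : X) : NH G R 𝕂 := RingQuot.mkAlgHom 𝕂 (nrel G R 𝕂) (eF 𝕂 x)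

/-- the generator `n_i^x` of the nil-Hecke algebra -/
def nN (x : X) (i : Fin θ) : NH G R 𝕂 := RingQuot.mkAlgHom 𝕂 (nrel G R 𝕂) (nF 𝕂 x i)

/-- the word `n_{i_1}^x n_{i_2} ⋯ n_{i_m}` in the nil-Hecke algebra -/
def nW (w : List (Fin θ)) (x : X) : NH G R 𝕂 := RingQuot.mkAlgHom 𝕂 (nrel G R 𝕂) (nWF G 𝕂 w x)

/-- the set of morphisms of the Weyl groupoid -/
def Mor := Σ (y : X) (x : X), homW G R y x

/-- the free `𝕂`-module `𝕂𝒲` on the set of morphisms of the Weyl groupoid -/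
abbrev KW := Mor G R →₀ 𝕂

/-- the endomorphism `E^x` of `𝕂𝒲` -/
def Emap (x : X) : KW G R 𝕂 →ₗ[𝕂] KW G R 𝕂 :=
  Finsupp.lift (KW G R 𝕂) 𝕂 (Mor G R)
    (fun m => if m.2.1 = x then Finsupp.single m 1 else 0)

/-- the value of the endomorphism `L_i^x` of `𝕂𝒲` on a basis morphism -/
def Lval (x : X) (i : Fin θ) (m : Mor G R) : KW G R 𝕂 :=
  if h : m.2.1 = G.ρ i x then
    (let f' : homW G R m.1 x := castTgt G R h m.2.2 ≫ genW G R x i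
     if len G R m.2.2 < len G R f' then Finsupp.single ⟨m.1, x, f'⟩ 1 else 0)
  else 0

/-- the endomorphism `L_i^x` of `𝕂𝒲` -/
def Lmap (x : X) (i : Fin θ) : KW G R 𝕂 →ₗ[𝕂] KW G R 𝕂 :=
  Finsupp.lift (KW G R 𝕂) 𝕂 (Mor G R) (Lval G R 𝕂 x i)

end NilHecke

end WeylGroupoid


namespace WeylGroupoid

section Involutions

variable {θ : ℕ} {X : Type} [Fintype X] [DecidableEq X] (G : SCG θ X)

theorem wsrc_altWord_iterate (n : ℕ) (i j : Fin θ) (x : X) :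
    wsrc G (altWord i j n) ((fun y => G.ρ i (G.ρ j y))^[n] x) = wsrc G (altWord j i n) x := by
  induction n generalizing i j x with
  | zero => rfl
  | succ n ih =>
    have hsemi : Function.Semiconj (G.ρ j) (fun y => G.ρ i (G.ρ j y))
        (fun y => G.ρ j (G.ρ i y)) := fun _ => rfl
    simp only [altWord, wsrc, Function.iterate_succ_apply', G.invol]
    rw [(hsemi.iterate_right n).eq, ih]

theorem wsrc_altWord_comm (R : GRS G) (x : X) (i j : Fin θ) :
    wsrc G (altWord i j (mnum G R x i j)) x = wsrc G (altWord j i (mnum G R x i j)) x := by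
  conv_rhs => rw [← wsrc_altWord_iterate]
  exact congrArg _ (R.loop x i j).symm

end Involutions

section Relations

variable {θ : ℕ} {X : Type} [Fintype X] [DecidableEq X] (G : SCG θ X) (R : GRS G)
  (𝕂 : Type) [CommRing 𝕂]

theorem eN_mul_eN (x y : X) :
    eN G R 𝕂 x * eN G R 𝕂 y = if x = y then eN G R 𝕂 x else 0 := by
  split_ifs with h
  · subst h
    exact (map_mul _ _ _).symm.trans (RingQuot.mkAlgHom_rel 𝕂 (nrel.idem x))
  · exact (map_mul _ _ _).symm.trans
      ((RingQuot.mkAlgHom_rel 𝕂 (nrel.orth x y h)).trans (map_zero _))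

theorem sum_eN : ∑ x, eN G R 𝕂 x = 1 :=
  (map_sum _ _ _).symm.trans ((RingQuot.mkAlgHom_rel 𝕂 nrel.total).trans (map_one _))

theorem nN_mul_eN_rho (x : X) (i : Fin θ) :
    nN G R 𝕂 x i * eN G R 𝕂 (G.ρ i x) = nN G R 𝕂 x i :=
  (map_mul _ _ _).symm.trans (RingQuot.mkAlgHom_rel 𝕂 (nrel.unit_right x i))

theorem eN_mul_nN_self (x : X) (i : Fin θ) :
    eN G R 𝕂 x * nN G R 𝕂 x i = nN G R 𝕂 x i :=
  (map_mul _ _ _).symm.trans (RingQuot.mkAlgHom_rel 𝕂 (nrel.unit_left x i))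

theorem eN_mul_nN (x y : X) (i : Fin θ) :
    eN G R 𝕂 x * nN G R 𝕂 y i = if x = y then nN G R 𝕂 y i else 0 := by
  rw [← eN_mul_nN_self, ← mul_assoc, eN_mul_eN]
  split_ifs with h
  · rw [h]
  · rw [zero_mul]

theorem nN_rho_mul_nN (x : X) (i : Fin θ) :
    nN G R 𝕂 (G.ρ i x) i * nN G R 𝕂 x i = 0 :=
  (map_mul _ _ _).symm.trans
    ((RingQuot.mkAlgHom_rel 𝕂 (nrel.nil x i)).trans (map_zero _))

theorem nN_mul_nN_rho (x : X) (i : Fin θ) :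
    nN G R 𝕂 x i * nN G R 𝕂 (G.ρ i x) i = 0 := by
  have h := nN_rho_mul_nN G R 𝕂 (G.ρ i x) i
  rwa [G.invol] at h

theorem nW_nil (x : X) : nW G R 𝕂 [] x = 1 := map_one _

theorem nW_cons (i : Fin θ) (l : List (Fin θ)) (x : X) :
    nW G R 𝕂 (i :: l) x = nN G R 𝕂 x i * nW G R 𝕂 l (G.ρ i x) := map_mul _ _ _

theorem nW_altWord_comm (x : X) (i j : Fin θ) (hij : i ≠ j) :
    nW G R 𝕂 (altWord i j (mnum G R x i j)) x = nW G R 𝕂 (altWord j i (mnum G R x i j)) x :=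
  RingQuot.mkAlgHom_rel 𝕂 (nrel.braid x i j hij)

variable {G R 𝕂}

theorem ext_eN_mul {a b : NH G R 𝕂} (h : ∀ x, eN G R 𝕂 x * a = eN G R 𝕂 x * b) : a = b := by
  rw [← one_mul a, ← one_mul b, ← sum_eN G R 𝕂, Finset.sum_mul, Finset.sum_mul]
  exact Finset.sum_congr rfl fun x _ => h x

@[elab_as_elim]
theorem NH.induction {p : NH G R 𝕂 → Prop}
    (algebraMap : ∀ r : 𝕂, p (algebraMap 𝕂 (NH G R 𝕂) r))
    (eN : ∀ x, p (eN G R 𝕂 x)) (nN : ∀ x i, p (nN G R 𝕂 x i))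
    (mul : ∀ a b, p a → p b → p (a * b)) (add : ∀ a b, p a → p b → p (a + b))
    (a : NH G R 𝕂) : p a := by
  obtain ⟨a, rfl⟩ := RingQuot.mkAlgHom_surjective 𝕂 (nrel G R 𝕂) a
  induction a using FreeAlgebra.induction with
  | grade0 r =>
    rw [AlgHom.commutes]
    exact algebraMap r
  | grade1 x =>
    rcases x with x | ⟨x, i⟩
    exacts [eN x, nN x i]
  | mul a b ha hb =>
    rw [map_mul]
    exact mul _ _ ha hb
  | add a b ha hb =>
    rw [map_add]
    exact add _ _ ha hb

end Relations

section Fibres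

variable {θ : ℕ} {X X' : Type} [DecidableEq X] [Fintype X'] [DecidableEq X']
  (G' : SCG θ X') (R' : GRS G') (𝕂 : Type) [CommRing 𝕂] (F : X' → X)

/-- The sum of the idempotents `e^y` over the fibre of `x`. -/
def fibE (x : X) : NH G' R' 𝕂 :=
  ∑ y ∈ Finset.univ.filter (fun y : X' => F y = x), eN G' R' 𝕂 y

/-- The sum of the generators `n_i^y` over the fibre of `x`. -/
def fibN (x : X) (i : Fin θ) : NH G' R' 𝕂 :=
  ∑ y ∈ Finset.univ.filter (fun y : X' => F y = x), nN G' R' 𝕂 y i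

theorem eN_mul_fibE (y : X') (x : X) :
    eN G' R' 𝕂 y * fibE G' R' 𝕂 F x = if F y = x then eN G' R' 𝕂 y else 0 := by
  simp [fibE, Finset.mul_sum, eN_mul_eN, Finset.sum_ite_eq]

theorem eN_mul_fibN (y : X') (x : X) (i : Fin θ) :
    eN G' R' 𝕂 y * fibN G' R' 𝕂 F x i = if F y = x then nN G' R' 𝕂 y i else 0 := by
  simp [fibN, Finset.mul_sum, eN_mul_nN, Finset.sum_ite_eq]

theorem nN_mul_fibE (y : X') (i : Fin θ) (x : X) :
    nN G' R' 𝕂 y i * fibE G' R' 𝕂 F x =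
      if F (G'.ρ i y) = x then nN G' R' 𝕂 y i else 0 := by
  rw [← nN_mul_eN_rho, mul_assoc, eN_mul_fibE, mul_ite, mul_zero]

theorem nN_mul_fibN (y : X') (i : Fin θ) (x : X) :
    nN G' R' 𝕂 y i * fibN G' R' 𝕂 F x i = 0 := by
  rw [← nN_mul_eN_rho, mul_assoc, eN_mul_fibN, mul_ite, mul_zero, nN_mul_nN_rho, ite_self]

/-- The covering map on the free algebra. -/
def coverFree : FreeAlgebra 𝕂 (X ⊕ X × Fin θ) →ₐ[𝕂] NH G' R' 𝕂 :=
  FreeAlgebra.lift 𝕂 (Sum.elim (fibE G' R' 𝕂 F) fun p => fibN G' R' 𝕂 F p.1 p.2)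

@[simp]
theorem coverFree_eF (x : X) : coverFree G' R' 𝕂 F (eF 𝕂 x) = fibE G' R' 𝕂 F x := by
  simp [coverFree, eF]

@[simp]
theorem coverFree_nF (x : X) (i : Fin θ) :
    coverFree G' R' 𝕂 F (nF 𝕂 x i) = fibN G' R' 𝕂 F x i := by
  simp [coverFree, nF]

end Fibres

section Covering

variable {θ : ℕ} {X X' : Type} [Fintype X] [DecidableEq X] [Fintype X'] [DecidableEq X']
  (G : SCG θ X) (R : GRS G) (G' : SCG θ X') (R' : GRS G') (𝕂 : Type) [CommRing 𝕂] {F : X' → X}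

theorem eN_mul_coverFree_nWF (hFρ : ∀ (i : Fin θ) (y : X'), G.ρ i (F y) = F (G'.ρ i y))
    (l : List (Fin θ)) (y : X') :
    eN G' R' 𝕂 y * coverFree G' R' 𝕂 F (nWF G 𝕂 l (F y)) = eN G' R' 𝕂 y * nW G' R' 𝕂 l y := by
  induction l generalizing y with
  | nil => simp [nWF, nW_nil]
  | cons i l ih =>
    rw [nWF, map_mul, coverFree_nF, ← mul_assoc, eN_mul_fibN, if_pos rfl, hFρ, nW_cons,
      ← mul_assoc, eN_mul_nN_self, ← nN_mul_eN_rho, mul_assoc, ih, mul_assoc]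

theorem eN_mul_coverFree_nWF_cons_of_ne (i : Fin θ) (l : List (Fin θ)) {x : X} {y : X'}
    (h : F y ≠ x) : eN G' R' 𝕂 y * coverFree G' R' 𝕂 F (nWF G 𝕂 (i :: l) x) = 0 := by
  rw [nWF, map_mul, coverFree_nF, ← mul_assoc, eN_mul_fibN, if_neg h, zero_mul]

theorem mnum_covering (hFΔ : ∀ (y : X'), R.Δ (F y) = R'.Δ y) (y : X') (i j : Fin θ) :
    mnum G R (F y) i j = mnum G' R' y i j := by
  rw [mnum, mnum, hFΔ]

theorem coverFree_rel (hFρ : ∀ (i : Fin θ) (y : X'), G.ρ i (F y) = F (G'.ρ i y))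
    (hFΔ : ∀ (y : X'), R.Δ (F y) = R'.Δ y) ⦃a b : FreeAlgebra 𝕂 (X ⊕ X × Fin θ)⦄
    (h : nrel G R 𝕂 a b) : coverFree G' R' 𝕂 F a = coverFree G' R' 𝕂 F b := by
  refine ext_eN_mul fun y => ?_
  cases h with
  | orth x x' hx =>
    rw [map_mul, coverFree_eF, coverFree_eF, ← mul_assoc, eN_mul_fibE, ite_mul, eN_mul_fibE]
    aesop
  | idem x =>
    rw [map_mul, coverFree_eF, ← mul_assoc, eN_mul_fibE, ite_mul, eN_mul_fibE]
    aesop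
  | total =>
    simp [Finset.mul_sum, eN_mul_fibE]
  | unit_right x i =>
    rw [map_mul, coverFree_eF, coverFree_nF, ← mul_assoc, eN_mul_fibN, ite_mul, nN_mul_fibE,
      zero_mul, ← hFρ]
    aesop
  | unit_left x i =>
    rw [map_mul, coverFree_eF, coverFree_nF, ← mul_assoc, eN_mul_fibE, ite_mul, eN_mul_fibN]
    aesop
  | nil x i =>
    rw [map_mul, coverFree_nF, coverFree_nF, ← mul_assoc, eN_mul_fibN, ite_mul, nN_mul_fibN]
    simp
  | braid x i j hij =>
    by_cases hx : F y = x
    · subst hx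
      rw [eN_mul_coverFree_nWF G G' R' 𝕂 hFρ, eN_mul_coverFree_nWF G G' R' 𝕂 hFρ,
        mnum_covering G R G' R' hFΔ, nW_altWord_comm G' R' 𝕂 y i j hij]
    · cases mnum G R x i j with
      | zero => rfl
      | succ m =>
        rw [altWord, altWord, eN_mul_coverFree_nWF_cons_of_ne G G' R' 𝕂 _ _ hx,
          eN_mul_coverFree_nWF_cons_of_ne G G' R' 𝕂 _ _ hx]

/-- The algebra map `𝒩 → 𝒩'` induced by a covering. -/
def cover (hFρ : ∀ (i : Fin θ) (y : X'), G.ρ i (F y) = F (G'.ρ i y))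
    (hFΔ : ∀ (y : X'), R.Δ (F y) = R'.Δ y) : NH G R 𝕂 →ₐ[𝕂] NH G' R' 𝕂 :=
  RingQuot.liftAlgHom 𝕂 ⟨coverFree G' R' 𝕂 F, coverFree_rel G R G' R' 𝕂 hFρ hFΔ⟩

theorem cover_eN (hFρ : ∀ (i : Fin θ) (y : X'), G.ρ i (F y) = F (G'.ρ i y))
    (hFΔ : ∀ (y : X'), R.Δ (F y) = R'.Δ y) (x : X) :
    cover G R G' R' 𝕂 hFρ hFΔ (eN G R 𝕂 x) = fibE G' R' 𝕂 F x :=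
  (RingQuot.liftAlgHom_mkAlgHom_apply 𝕂 _ _ _).trans (coverFree_eF G' R' 𝕂 F x)

theorem cover_nN (hFρ : ∀ (i : Fin θ) (y : X'), G.ρ i (F y) = F (G'.ρ i y))
    (hFΔ : ∀ (y : X'), R.Δ (F y) = R'.Δ y) (x : X) (i : Fin θ) :
    cover G R G' R' 𝕂 hFρ hFΔ (nN G R 𝕂 x i) = fibN G' R' 𝕂 F x i :=
  (RingQuot.liftAlgHom_mkAlgHom_apply 𝕂 _ _ _).trans (coverFree_nF G' R' 𝕂 F x i)

variable (F)

/-- The map from the free algebra to matrices over `𝒩` sending `e^y` to the matrix unit `E_{y,y}`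
and `n_i^y` to `n_i^{F(y)} E_{y,ρ_i(y)}`. -/
def matFree : FreeAlgebra 𝕂 (X' ⊕ X' × Fin θ) →ₐ[𝕂] Matrix X' X' (NH G R 𝕂) :=
  FreeAlgebra.lift 𝕂 (Sum.elim (fun y => Matrix.single y y 1)
    fun p => Matrix.single p.1 (G'.ρ p.2 p.1) (nN G R 𝕂 (F p.1) p.2))

@[simp]
theorem matFree_eF (y : X') : matFree G R G' 𝕂 F (eF 𝕂 y) = Matrix.single y y 1 := by
  simp [matFree, eF]

@[simp]
theorem matFree_nF (y : X') (i : Fin θ) :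
    matFree G R G' 𝕂 F (nF 𝕂 y i) = Matrix.single y (G'.ρ i y) (nN G R 𝕂 (F y) i) := by
  simp [matFree, nF]

variable {F}

theorem single_mul_matFree_nWF (hFρ : ∀ (i : Fin θ) (y : X'), G.ρ i (F y) = F (G'.ρ i y))
    (l : List (Fin θ)) (y : X') (z : X') (a : NH G R 𝕂) :
    Matrix.single z y a * matFree G R G' 𝕂 F (nWF G' 𝕂 l y) =
      Matrix.single z (wsrc G' l y) (a * nW G R 𝕂 l (F y)) := by
  induction l generalizing y a with
  | nil => simp [nWF, nW_nil, wsrc]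
  | cons i l ih =>
    rw [nWF, map_mul, matFree_nF, ← mul_assoc, Matrix.single_mul_single_same, ih, nW_cons, hFρ,
      mul_assoc, wsrc]

theorem matFree_nWF_cons (hFρ : ∀ (i : Fin θ) (y : X'), G.ρ i (F y) = F (G'.ρ i y))
    (i : Fin θ) (l : List (Fin θ)) (y : X') :
    matFree G R G' 𝕂 F (nWF G' 𝕂 (i :: l) y) =
      Matrix.single y (wsrc G' (i :: l) y) (nW G R 𝕂 (i :: l) (F y)) := by
  rw [nWF, map_mul, matFree_nF, single_mul_matFree_nWF G R G' 𝕂 hFρ, nW_cons, hFρ, wsrc]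

theorem matFree_rel (hFρ : ∀ (i : Fin θ) (y : X'), G.ρ i (F y) = F (G'.ρ i y))
    (hFΔ : ∀ (y : X'), R.Δ (F y) = R'.Δ y) ⦃a b : FreeAlgebra 𝕂 (X' ⊕ X' × Fin θ)⦄
    (h : nrel G' R' 𝕂 a b) : matFree G R G' 𝕂 F a = matFree G R G' 𝕂 F b := by
  cases h with
  | orth x y hxy => simp [hxy]
  | idem x => simp
  | total =>
    simp only [map_sum, matFree_eF, map_one]
    ext y z
    simp [Matrix.sum_apply, Matrix.single_apply, Matrix.one_apply, ite_and]
  | unit_right x i => simp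
  | unit_left x i => simp
  | nil x i =>
    rw [map_mul, matFree_nF, matFree_nF, G'.invol, Matrix.single_mul_single_same, ← hFρ,
      nN_rho_mul_nN, Matrix.single_zero, map_zero]
  | braid x i j hij =>
    have hsrc := wsrc_altWord_comm G' R' x i j
    have hword := nW_altWord_comm G R 𝕂 (F x) i j hij
    rw [mnum_covering G R G' R' hFΔ] at hword
    revert hsrc hword
    cases mnum G' R' x i j with
    | zero => intros; rfl
    | succ m =>
      intro hsrc hword
      simp only [altWord] at hsrc hword ⊢
      rw [matFree_nWF_cons G R G' 𝕂 hFρ, matFree_nWF_cons G R G' 𝕂 hFρ, hsrc, hword]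

/-- The matrix representation of `𝒩'` over `𝒩` attached to a covering. -/
def mat (hFρ : ∀ (i : Fin θ) (y : X'), G.ρ i (F y) = F (G'.ρ i y))
    (hFΔ : ∀ (y : X'), R.Δ (F y) = R'.Δ y) : NH G' R' 𝕂 →ₐ[𝕂] Matrix X' X' (NH G R 𝕂) :=
  RingQuot.liftAlgHom 𝕂 ⟨matFree G R G' 𝕂 F, matFree_rel G R G' R' 𝕂 hFρ hFΔ⟩

theorem mat_eN (hFρ : ∀ (i : Fin θ) (y : X'), G.ρ i (F y) = F (G'.ρ i y))
    (hFΔ : ∀ (y : X'), R.Δ (F y) = R'.Δ y) (y : X') :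
    mat G R G' R' 𝕂 hFρ hFΔ (eN G' R' 𝕂 y) = Matrix.single y y 1 :=
  (RingQuot.liftAlgHom_mkAlgHom_apply 𝕂 _ _ _).trans (matFree_eF G R G' 𝕂 F y)

theorem mat_nN (hFρ : ∀ (i : Fin θ) (y : X'), G.ρ i (F y) = F (G'.ρ i y))
    (hFΔ : ∀ (y : X'), R.Δ (F y) = R'.Δ y) (y : X') (i : Fin θ) :
    mat G R G' R' 𝕂 hFρ hFΔ (nN G' R' 𝕂 y i) =
      Matrix.single y (G'.ρ i y) (nN G R 𝕂 (F y) i) :=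
  (RingQuot.liftAlgHom_mkAlgHom_apply 𝕂 _ _ _).trans (matFree_nF G R G' 𝕂 F y i)

theorem commute_diagonal_mat (hFρ : ∀ (i : Fin θ) (y : X'), G.ρ i (F y) = F (G'.ρ i y))
    (hFΔ : ∀ (y : X'), R.Δ (F y) = R'.Δ y) (a : NH G' R' 𝕂) :
    Commute (Matrix.diagonal fun y => eN G R 𝕂 (F y)) (mat G R G' R' 𝕂 hFρ hFΔ a) := by
  induction a using NH.induction with
  | algebraMap r =>
    rw [AlgHom.commutes]
    exact (Algebra.commutes r _).symm
  | eN y =>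
    rw [mat_eN]
    ext u v
    simp [Matrix.single_apply]
    aesop
  | nN y i =>
    rw [mat_nN]
    ext u v
    simp only [Matrix.diagonal_mul, Matrix.mul_diagonal, Matrix.single_apply]
    split_ifs with h
    · obtain ⟨rfl, rfl⟩ := h
      rw [eN_mul_nN_self, ← hFρ, nN_mul_eN_rho]
    · simp
  | mul a b ha hb =>
    rw [map_mul]
    exact ha.mul_right hb
  | add a b ha hb =>
    rw [map_add]
    exact ha.add_right hb

theorem eN_mul_mat (hFρ : ∀ (i : Fin θ) (y : X'), G.ρ i (F y) = F (G'.ρ i y))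
    (hFΔ : ∀ (y : X'), R.Δ (F y) = R'.Δ y) (a : NH G' R' 𝕂) (y z : X') :
    eN G R 𝕂 (F y) * mat G R G' R' 𝕂 hFρ hFΔ a y z =
      mat G R G' R' 𝕂 hFρ hFΔ a y z * eN G R 𝕂 (F z) := by
  simpa using congrFun₂ (commute_diagonal_mat G R G' R' 𝕂 hFρ hFΔ a).eq y z

/-- Up to the idempotent `e^{F(y)}`, an element of `𝒩` is the `y`-th row sum of the matrix
of its image in `𝒩'`. -/
theorem eN_mul_sum_mat_cover (hFρ : ∀ (i : Fin θ) (y : X'), G.ρ i (F y) = F (G'.ρ i y))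
    (hFΔ : ∀ (y : X'), R.Δ (F y) = R'.Δ y) (a : NH G R 𝕂) (y : X') :
    eN G R 𝕂 (F y) * ∑ z, mat G R G' R' 𝕂 hFρ hFΔ (cover G R G' R' 𝕂 hFρ hFΔ a) y z =
      eN G R 𝕂 (F y) * a := by
  induction a using NH.induction generalizing y with
  | algebraMap r =>
    simp [Matrix.algebraMap_matrix_apply]
  | eN x =>
    simp only [cover_eN, fibE, map_sum, mat_eN, Matrix.sum_apply, Matrix.single_apply, eN_mul_eN]
    rw [Finset.sum_comm]
    simp [ite_and, Finset.sum_ite_eq]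
  | nN x i =>
    simp only [cover_nN, fibN, map_sum, mat_nN, Matrix.sum_apply, Matrix.single_apply, eN_mul_nN]
    rw [Finset.sum_comm]
    simp [ite_and, Finset.sum_ite_eq, eN_mul_nN]
    aesop
  | mul a b ha hb =>
    simp only [map_mul, Matrix.mul_apply]
    rw [Finset.sum_comm]
    simp only [← Finset.mul_sum]
    rw [← mul_assoc (eN G R 𝕂 (F y)), ← ha, Finset.mul_sum, Finset.mul_sum, Finset.sum_mul]
    refine Finset.sum_congr rfl fun z _ => ?_
    rw [← mul_assoc, eN_mul_mat, mul_assoc, hb, mul_assoc]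
  | add a b ha hb =>
    simp only [map_add, Matrix.add_apply, Finset.sum_add_distrib, mul_add, ha, hb]

theorem cover_injective (hFsurj : Function.Surjective F)
    (hFρ : ∀ (i : Fin θ) (y : X'), G.ρ i (F y) = F (G'.ρ i y))
    (hFΔ : ∀ (y : X'), R.Δ (F y) = R'.Δ y) :
    Function.Injective (cover G R G' R' 𝕂 hFρ hFΔ) := by
  intro a b hab
  refine ext_eN_mul fun x => ?_
  obtain ⟨y, rfl⟩ := hFsurj x
  rw [← eN_mul_sum_mat_cover G R G' R' 𝕂 hFρ hFΔ a y, hab, eN_mul_sum_mat_cover]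

end Covering

/-- **Coverings induce injective maps of nil-Hecke algebras.**
If `F : X̃ → X` is a covering of semi-Cartan graphs with generalized root systems
(surjective, equivariant, matching Cartan matrices and root sets), then there is a
well-defined injective `𝕂`-algebra homomorphism `𝒩 → 𝒩'` with
`e^x ↦ Σ_{y ∈ F⁻¹(x)} e^y` and `n_i^x ↦ Σ_{y ∈ F⁻¹(x)} n_i^y`. -/
theorem covering_nilHecke_embedding {θ : ℕ} {X X' : Type}
    [Fintype X] [DecidableEq X] [Fintype X'] [DecidableEq X']
    (G : SCG θ X) (R : GRS G) (G' : SCG θ X') (R' : GRS G')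
    (𝕂 : Type) [CommRing 𝕂]
    (F : X' → X)
    (hFsurj : Function.Surjective F)
    (hFρ : ∀ (i : Fin θ) (y : X'), G.ρ i (F y) = F (G'.ρ i y))
    (hFC : ∀ (y : X'), G.C (F y) = G'.C y)
    (hFΔ : ∀ (y : X'), R.Δ (F y) = R'.Δ y) :
    ∃ Φ : NH G R 𝕂 →ₐ[𝕂] NH G' R' 𝕂,
      Function.Injective Φ ∧
      (∀ x : X, Φ (eN G R 𝕂 x) =
        ∑ y ∈ Finset.univ.filter (fun y : X' => F y = x), eN G' R' 𝕂 y) ∧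
      (∀ (x : X) (i : Fin θ), Φ (nN G R 𝕂 x i) =
        ∑ y ∈ Finset.univ.filter (fun y : X' => F y = x), nN G' R' 𝕂 y i) := by
  exact ⟨cover G R G' R' 𝕂 hFρ hFΔ, cover_injective G R G' R' 𝕂 hFsurj hFρ hFΔ,
    cover_eN G R G' R' 𝕂 hFρ hFΔ, cover_nN G R G' R' 𝕂 hFρ hFΔ⟩

end WeylGroupoid
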